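/- arXiv:2003.05160 — 2 statements merged into one kernel-verified Lean document; each statement's English description precedes it below -/
import Mathlib

section
/- Suppose a mixed-criticality task has equal virtual deadlines D^m = D^{m−1} = D (i.e., no deadline tuning is applied) and strictly increasing budgets C^{m−1} < C^m. Then for every real e with 0 < e ≤ C^{m−1} and e < D, the single-mode demand bound function satisfies dbf_SM(e) = C^m − C^{m−1} + e; in particular dbf_SM(e) > e, so the single-mode demand-based schedulability condition for level-m mode necessarily fails when C^m > C^{m−1} and no virtual deadline is used. -/
/-- `x mod T`: the remainder of `x` upon division by `T`, lying in `[0, T)`. -/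
noncomputable def rmod (x T : ℝ) : ℝ := x - T * (⌊x / T⌋ : ℤ)

/-- The demand of the carry-over job that must be finished before the mode switch. -/
noncomputable def doneSM (T Cm1 Cm Dm1 Dm e : ℝ) : ℝ :=
  if Dm - Dm1 ≤ rmod e T ∧ rmod e T < Dm then max 0 (Cm1 - rmod e T + Dm - Dm1) else 0

/-- The single-mode (SM) demand bound function for level-`m` mode of a task with
period `T`, budgets `Cm1 ≤ Cm` and virtual relative deadlines `Dm1 ≤ Dm`. -/
noncomputable def dbfSM (T Cm1 Cm Dm1 Dm e : ℝ) : ℝ :=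
  max 0 ((((⌊(e - (Dm - Dm1)) / T⌋ : ℤ) : ℝ) + 1) * Cm) - doneSM T Cm1 Cm Dm1 Dm e

/-- If a task has equal virtual deadlines `D^m = D^{m-1} = D` (no deadline tuning)
and strictly increasing budgets `C^{m-1} < C^m`, then for every `0 < e ≤ C^{m-1}`
with `e < D`, we have `dbf_SM(e) = C^m − C^{m-1} + e`, and in particular
`dbf_SM(e) > e`, so the single-mode demand condition for level-`m` mode fails. -/
theorem dbfSM_no_tuning_fails
    (T Cm1 Cm D : ℝ) (hT : 0 < T)
    (hCm1 : 0 < Cm1) (hCC : Cm1 < Cm)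
    (hCm1D : Cm1 ≤ D) (hCmD : Cm ≤ D) (hDT : D ≤ T) :
    ∀ e : ℝ, 0 < e → e ≤ Cm1 → e < D →
      dbfSM T Cm1 Cm D D e = Cm - Cm1 + e ∧ dbfSM T Cm1 Cm D D e > e := by
  intro e he heC heD
  have hdiv : ⌊e / T⌋ = 0 := by
    rw [Int.floor_eq_zero_iff]
    exact ⟨by positivity, (div_lt_one hT).2 (by linarith)⟩
  have hmod : rmod e T = e := by simp [rmod, hdiv]
  have hdone : doneSM T Cm1 Cm D D e = Cm1 - e := by
    rw [doneSM, hmod, if_pos ⟨by linarith, heD⟩, max_eq_right (by linarith)]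
    ring
  have hdbf : dbfSM T Cm1 Cm D D e = Cm - Cm1 + e := by
    rw [dbfSM, hdone, sub_self, sub_zero, hdiv, Int.cast_zero, zero_add, one_mul,
      max_eq_right (by linarith)]
    ring
  exact ⟨hdbf, by linarith⟩
end

section
/- (Affine demand bound for a level-≥m task.) For every r ∈ [−T, 0], the total demand satisfies DEM(r) ≤ (S/T)·C'' + 2·C''' + max(0, e − S − D''' + T)·(C'''/T); that is, the demand that a task of criticality level at least m can generate over [0, e) is bounded by an expression affine in S and e. -/
/-- Demand in `[0, e)` of the carry-over job `J^C` (active at the switch into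
level-(m−1) mode at time 0) of a level-≥m task, released at time `r`. -/
noncomputable def Cdem (C' C'' C''' D' D'' D''' e S r : ℝ) : ℝ :=
  if r + D' < 0 ∨ e < r + D'' then 0
  else if r + D'' < S then C'' - C' + min (r + D') C'
  else if r + D''' ≤ e then C''' - C' + min (r + D') C'
  else min S (C'' - C' + min (r + D') C')

/-- Demand in `[0, e)` of the carry-over job `J^D` (active at the switch into
level-m mode at time `S`) of a level-≥m task, released at time `s`. -/
noncomputable def Ddem (C'' C''' D'' D''' e S s : ℝ) : ℝ :=
  if e < s + D'' then 0
  else if s + D'' < S then C''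
  else if s + D''' ≤ e then C'''
  else min C'' (S - s)

/-- Total demand of a level-≥m task in `[0, e)` when its carry-over job `J^C`
is released at time `r` and all subsequent jobs are released as early as
possible (every `T` time units). -/
noncomputable def DEM (T C' C'' C''' D' D'' D''' e S r : ℝ) : ℝ :=
  if S < r + T then
    Cdem C' C'' C''' D' D'' D''' e S r
      + ((max 0 (⌊(e - (r + T) - D''') / T⌋ + 1) : ℤ) : ℝ) * C'''
  else
    Cdem C' C'' C''' D' D'' D''' e S r
      + ((⌊(S - r - T) / T⌋ : ℤ) : ℝ) * C''
      + Ddem C'' C''' D'' D''' e S (r + (((⌊(S - r - T) / T⌋ : ℤ) : ℝ) + 1) * T)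
      + ((max 0 (⌊(e - (r + (((⌊(S - r - T) / T⌋ : ℤ) : ℝ) + 2) * T) - D''') / T⌋ + 1) : ℤ) : ℝ)
          * C'''

/-- A `J^C` carry-over job never demands more than its largest budget. -/
lemma Cdem_le {C' C'' C''' D' D'' D''' e S r : ℝ}
    (hC''' : 0 ≤ C''') (h : C'' ≤ C''') :
    Cdem C' C'' C''' D' D'' D''' e S r ≤ C''' := by
  have h1 : min (r + D') C' ≤ C' := min_le_right _ _
  have h2 : min S (C'' - C' + min (r + D') C') ≤ C'' - C' + min (r + D') C' := min_le_right _ _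
  unfold Cdem
  split_ifs <;> linarith

/-- A `J^D` carry-over job never demands more than its largest budget. -/
lemma Ddem_le {C'' C''' D'' D''' e S s : ℝ}
    (hC''' : 0 ≤ C''') (h : C'' ≤ C''') :
    Ddem C'' C''' D'' D''' e S s ≤ C''' := by
  have h1 : min C'' (S - s) ≤ C'' := min_le_left _ _
  unfold Ddem
  split_ifs <;> linarith

/-- Demand of the jobs released from time `x ≥ S` on, every `T` time units, with relative
deadline `D` and budget `C`. -/
lemma max_floor_mul_le {T C D e S x : ℝ} (hT : 0 < T) (hC : 0 ≤ C) (hx : S ≤ x) :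
    ((max 0 (⌊(e - x - D) / T⌋ + 1) : ℤ) : ℝ) * C ≤ max 0 (e - S - D + T) * (C / T) := by
  have hfloor : (⌊(e - x - D) / T⌋ : ℝ) + 1 ≤ (e - S - D + T) / T := by
    rw [add_div, div_self hT.ne']
    gcongr
    exact (Int.floor_le _).trans (by gcongr)
  have hmax : ((max 0 (⌊(e - x - D) / T⌋ + 1) : ℤ) : ℝ) ≤ max 0 (e - S - D + T) / T := by
    push_cast
    refine max_le (by positivity) (hfloor.trans ?_)
    gcongr
    exact le_max_right _ _
  calc _ ≤ max 0 (e - S - D + T) / T * C := by gcongr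
    _ = _ := by ring

/-- Affine demand bound for a level-≥m task: its total demand over `[0, e)` is
bounded by `(S/T)·C'' + 2·C''' + max(0, e − S − D''' + T)·(C'''/T)`, an
expression affine in `S` and `e`. -/
theorem affine_demand_bound_level_ge_m
    (T C' C'' C''' D' D'' D''' e S : ℝ)
    (hT : 0 < T) (hC' : 0 < C') (hC'C'' : C' ≤ C'') (hC''C''' : C'' ≤ C''')
    (hC'D' : C' ≤ D') (hC''D'' : C'' ≤ D'') (hC'''D''' : C''' ≤ D''')
    (hD'D'' : D' ≤ D'') (hD''D''' : D'' ≤ D''') (hD'''T : D''' ≤ T)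
    (hS0 : 0 ≤ S) (hSe : S ≤ e) :
    ∀ r : ℝ, -T ≤ r → r ≤ 0 →
      DEM T C' C'' C''' D' D'' D''' e S r ≤
        (S / T) * C'' + 2 * C''' + max 0 (e - S - D''' + T) * (C''' / T) := by
  intro r hr _
  have hC'' : 0 ≤ C'' := by linarith
  have hC''' : 0 ≤ C''' := by linarith
  have hCdem : Cdem C' C'' C''' D' D'' D''' e S r ≤ C''' := Cdem_le hC''' hC''C'''
  unfold DEM
  split_ifs with h
  · have hSC : 0 ≤ S / T * C'' := by positivity
    linarith [max_floor_mul_le (D := D''') (e := e) hT hC''' h.le]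
  · set n := ⌊(S - r - T) / T⌋
    have hn : (n : ℝ) * C'' ≤ S / T * C'' := by
      gcongr
      exact (Int.floor_le _).trans (by gcongr; linarith)
    have hnext : S ≤ r + ((n : ℝ) + 2) * T := by
      have := (div_lt_iff₀ hT).1 (Int.lt_floor_add_one ((S - r - T) / T))
      linarith
    have hDdem : Ddem C'' C''' D'' D''' e S (r + ((n : ℝ) + 1) * T) ≤ C''' :=
      Ddem_le hC''' hC''C'''
    linarith [max_floor_mul_le (D := D''') (e := e) hT hC''' hnext]
end
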